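/- In the group P, for every i ≥ 1 the element α_i = mk(a₁^i ⋯ a₂₀^i) is conjugate to β_i = mk(b₁^i ⋯ b₂₀^i) or to β_i⁻¹; moreover α_i is conjugate to β_i if and only if i ∈ S, and α_i is conjugate to β_i⁻¹ if and only if i ∉ S. -/

import Mathlib

/-- A word over the alphabet `α`: a list of generators with signs. -/
abbrev Word (α : Type*) := List (α × Bool)

/-- The formal inverse of a word. -/
def wordInv {α : Type*} (w : Word α) : Word α := FreeGroup.invRev w

/-- A word is reduced if it equals its free reduction. -/
def Reduced {α : Type*} [DecidableEq α] (w : Word α) : Prop := FreeGroup.reduce w = w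

/-- A word is cyclically reduced if it is reduced and its first letter is not
the inverse of its last letter. -/
def CyclicallyReduced {α : Type*} [DecidableEq α] (w : Word α) : Prop :=
  Reduced w ∧ ∀ a ∈ w.head?, ∀ b ∈ w.getLast?, a ≠ (b.1, !b.2)

/-- A nonempty word `b` is a piece relative to `R` if it is an initial segment of two
distinct elements of `R`. -/
def Piece {α : Type*} (R : Set (Word α)) (b : Word α) : Prop :=
  b ≠ [] ∧ ∃ r₁ ∈ R, ∃ r₂ ∈ R, r₁ ≠ r₂ ∧ b <+: r₁ ∧ b <+: r₂

/-- The symmetrized closure of a set of (cyclically reduced) words: all cyclic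
permutations of the words and of their formal inverses. -/
def symClosure {α : Type*} (S : Set (Word α)) : Set (Word α) :=
  {w | ∃ r ∈ S, w ~r r ∨ w ~r wordInv r}

/-! The 46 generators: `a₁,…,a₂₀` are `0,…,19`, `b₁,…,b₂₀` are `20,…,39`,
`c₁,c₂,c₃` are `40,41,42` and `d₁,d₂,d₃` are `43,44,45`. -/

def genA (k : Fin 20) : Fin 46 := ⟨(k : ℕ), by have := k.isLt; omega⟩
def genB (k : Fin 20) : Fin 46 := ⟨20 + (k : ℕ), by have := k.isLt; omega⟩
def genC (k : Fin 3) : Fin 46 := ⟨40 + (k : ℕ), by have := k.isLt; omega⟩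
def genD (k : Fin 3) : Fin 46 := ⟨43 + (k : ℕ), by have := k.isLt; omega⟩

/-- The word `x^n` (with sign `s`: `true` is `x^n`, `false` is `x^{-n}`). -/
def genPow (x : Fin 46) (s : Bool) (n : ℕ) : Word (Fin 46) := List.replicate n (x, s)

/-- The word `a₁^j a₂^j ⋯ a₂₀^j`. -/
def aWord (j : ℕ) : Word (Fin 46) :=
  (List.ofFn fun k : Fin 20 => genPow (genA k) true j).flatten

/-- The word `b₁^j b₂^j ⋯ b₂₀^j`. -/
def bWord (j : ℕ) : Word (Fin 46) :=
  (List.ofFn fun k : Fin 20 => genPow (genB k) true j).flatten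

/-- The word `b₂₀^{-j} b₁₉^{-j} ⋯ b₁^{-j}`. -/
def bWordRevInv (j : ℕ) : Word (Fin 46) :=
  (List.ofFn fun k : Fin 20 => genPow (genB k.rev) false j).flatten

/-- The conjugating word `c₁^i d₁^{t} c₂^i d₂^{t} c₃^i d₃^{t}`. -/
def conjWord (i ti : ℕ) : Word (Fin 46) :=
  genPow (genC 0) true i ++ genPow (genD 0) true ti ++
  genPow (genC 1) true i ++ genPow (genD 1) true ti ++
  genPow (genC 2) true i ++ genPow (genD 2) true ti

/-- The inverse conjugating word `d₃^{-t} c₃^{-i} d₂^{-t} c₂^{-i} d₁^{-t} c₁^{-i}`. -/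
def conjWordInv (i ti : ℕ) : Word (Fin 46) :=
  genPow (genD 2) false ti ++ genPow (genC 2) false i ++
  genPow (genD 1) false ti ++ genPow (genC 1) false i ++
  genPow (genD 0) false ti ++ genPow (genC 0) false i

/-- The relator
`r_i = a₁^j ⋯ a₂₀^j · c₁^i d₁^{t(i)} ⋯ c₃^i d₃^{t(i)} · b₂₀^{-j} ⋯ b₁^{-j} · d₃^{-t(i)} ⋯ c₁^{-i}`
where `j = f i`. -/
def relatorWord (f t : ℕ → ℕ) (i : ℕ) : Word (Fin 46) :=
  aWord (f i) ++ conjWord i (t i) ++ bWordRevInv (f i) ++ conjWordInv i (t i)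

/-- The set of relators `{r_i : i ≥ 1}` as elements of the free group. -/
def relatorSet (f t : ℕ → ℕ) : Set (FreeGroup (Fin 46)) :=
  {r | ∃ i : ℕ, 1 ≤ i ∧ r = FreeGroup.mk (relatorWord f t i)}

/-- The group `G`: the quotient of the free group on the 46 generators by the
normal closure of the relators `r_i`, `i ≥ 1`. -/
abbrev GroupG (f t : ℕ → ℕ) : Type :=
  FreeGroup (Fin 46) ⧸ Subgroup.normalClosure (relatorSet f t)

/-- The quotient map `mk : F → G` (on words). -/
def mkG (f t : ℕ → ℕ) (w : Word (Fin 46)) : GroupG f t :=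
  QuotientGroup.mk (FreeGroup.mk w)

open Classical in
/-- The relator `r_i` of the group `P`: if `i ∈ S` it conjugates `a₁^i ⋯ a₂₀^i` to
`b₁^i ⋯ b₂₀^i`, and if `i ∉ S` it conjugates `a₁^i ⋯ a₂₀^i` to `(b₁^i ⋯ b₂₀^i)⁻¹`. -/
noncomputable def relatorWordP (S : Set ℕ) (t : ℕ → ℕ) (i : ℕ) : Word (Fin 46) :=
  if i ∈ S then
    aWord i ++ conjWord i (t i) ++ bWordRevInv i ++ conjWordInv i (t i)
  else
    aWord i ++ conjWord i (t i) ++ bWord i ++ conjWordInv i (t i)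

/-- The set of relators `{r_i : i ≥ 1}` of `P` as elements of the free group. -/
def relatorSetP (S : Set ℕ) (t : ℕ → ℕ) : Set (FreeGroup (Fin 46)) :=
  {r | ∃ i : ℕ, 1 ≤ i ∧ r = FreeGroup.mk (relatorWordP S t i)}

/-- The group `P`. -/
abbrev GroupP (S : Set ℕ) (t : ℕ → ℕ) : Type :=
  FreeGroup (Fin 46) ⧸ Subgroup.normalClosure (relatorSetP S t)

/-- The quotient map `mk : F → P` (on words). -/
def mkP (S : Set ℕ) (t : ℕ → ℕ) (w : Word (Fin 46)) : GroupP S t :=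
  QuotientGroup.mk (FreeGroup.mk w)
namespace HalfConj

/-- The shift of the first coordinate by `n`. -/
def shiftPerm (n : ℤ) : Equiv.Perm ((ℤ → ℤ) × ℤ) where
  toFun p := (fun m => p.1 (m - n), p.2)
  invFun p := (fun m => p.1 (m + n), p.2)
  left_inv p := by ext <;> simp
  right_inv p := by ext <;> simp

/-- Translation of the phase. -/
def phasePerm (s : ℤ) : Equiv.Perm ((ℤ → ℤ) × ℤ) where
  toFun p := (p.1, p.2 + s)
  invFun p := (p.1, p.2 - s)
  left_inv p := by ext <;> simp
  right_inv p := by ext <;> simp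

/-- Add a delta function at `n`, and twist the phase by the value at `n - i`. -/
def bumpPerm (i : ℕ) (hi : 1 ≤ i) (n : ℤ) : Equiv.Perm ((ℤ → ℤ) × ℤ) where
  toFun p := (p.1 + Pi.single n 1, p.2 + p.1 (n - i))
  invFun p := (p.1 - Pi.single n 1, p.2 - p.1 (n - i))
  left_inv p := by
    have h : n - (i : ℤ) ≠ n := by omega
    ext <;> simp [Pi.single_eq_of_ne h]
  right_inv p := by
    have h : n - (i : ℤ) ≠ n := by omega
    ext <;> simp [Pi.single_eq_of_ne h]

lemma shift_pow (n : ℕ) : (shiftPerm 1) ^ n = shiftPerm n := by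
  induction n with
  | zero => ext p <;> simp [shiftPerm]
  | succ k ih =>
    rw [pow_succ, ih]
    ext p
    · simp [shiftPerm, sub_sub]
    · simp [shiftPerm]

lemma shift_bump (i : ℕ) (hi : 1 ≤ i) (n : ℤ) :
    shiftPerm n * bumpPerm i hi 0 = bumpPerm i hi n * shiftPerm n := by
  ext p m
  · simp [shiftPerm, bumpPerm, Pi.single_apply, sub_eq_zero]
  · simp [shiftPerm, bumpPerm]

lemma bump_bump (i : ℕ) (hi : 1 ≤ i) (n : ℕ) (hn : 1 ≤ n) :
    bumpPerm i hi 0 * bumpPerm i hi n =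
      phasePerm (if n = i then -1 else 0) * (bumpPerm i hi n * bumpPerm i hi 0) := by
  ext p m
  · simp [bumpPerm, phasePerm]; ring
  · have h1 : (0 - (i : ℤ)) ≠ n := by omega
    have h2 : ((n : ℤ) - i = 0) ↔ n = i := by omega
    simp only [bumpPerm, phasePerm, Equiv.Perm.mul_apply, Equiv.coe_fn_mk, Pi.add_apply,
      Pi.single_apply, h1, h2, if_false]
    split_ifs <;> ring

lemma exists_group (i : ℕ) (hi : 1 ≤ i) : ∃ (Q : Type) (_ : Group Q) (x t z : Q),
    (∀ g, z * g = g * z) ∧ z ≠ z⁻¹ ∧ ∀ n : ℕ, 1 ≤ n →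
      x * (t ^ n * x * (t ^ n)⁻¹) * x⁻¹ * (t ^ n * x * (t ^ n)⁻¹)⁻¹ =
        if n = i then z else 1 := by
  let Z := phasePerm (-1)
  let C := Subgroup.centralizer {Z}
  have hx : bumpPerm i hi 0 ∈ C := by
    rw [Subgroup.mem_centralizer_singleton_iff]
    ext p m <;> simp [Z, bumpPerm, phasePerm]; try ring
  have ht : shiftPerm 1 ∈ C := by
    rw [Subgroup.mem_centralizer_singleton_iff]
    ext p m <;> simp [Z, shiftPerm, phasePerm]
  have hz : Z ∈ C := by
    rw [Subgroup.mem_centralizer_singleton_iff]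
  refine ⟨C, inferInstance, ⟨_, hx⟩, ⟨_, ht⟩, ⟨_, hz⟩, ?_, ?_, ?_⟩
  · rintro ⟨g, hg⟩
    rw [Subgroup.mem_centralizer_singleton_iff] at hg
    exact Subtype.ext hg.symm
  · intro h
    have h1 : Z = Z⁻¹ := congrArg Subtype.val h
    have h2 : Z * Z = 1 := by
      nth_rewrite 2 [h1]
      simp
    have h3 := congrArg (fun e : Equiv.Perm ((ℤ → ℤ) × ℤ) => (e (0, 0)).2) h2
    simp [Z, phasePerm] at h3
  · intro n hn
    have key : bumpPerm i hi 0 * (shiftPerm 1 ^ n * bumpPerm i hi 0 * (shiftPerm 1 ^ n)⁻¹) *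
        (bumpPerm i hi 0)⁻¹ * (shiftPerm 1 ^ n * bumpPerm i hi 0 * (shiftPerm 1 ^ n)⁻¹)⁻¹ =
        phasePerm (if n = i then -1 else 0) := by
      rw [shift_pow, shift_bump, mul_inv_cancel_right, bump_bump i hi n hn]
      group
    apply Subtype.ext
    have h0 : phasePerm 0 = 1 := by ext p <;> simp [phasePerm]
    by_cases h : n = i
    · rw [if_pos h] at key ⊢
      exact key
    · rw [if_neg h, h0] at key
      rw [if_neg h]
      exact key

lemma mk_app (u v : Word (Fin 46)) :
    FreeGroup.mk (u ++ v) = FreeGroup.mk u * FreeGroup.mk v := FreeGroup.mul_mk.symm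

lemma mk_flatten (L : List (Word (Fin 46))) :
    FreeGroup.mk L.flatten = (L.map FreeGroup.mk).prod := by
  induction L with
  | nil => rfl
  | cons a L ih => rw [List.flatten_cons, mk_app, ih, List.map_cons, List.prod_cons]

lemma mk_pow_true (x : Fin 46) (n : ℕ) :
    FreeGroup.mk (genPow x true n) = FreeGroup.of x ^ n := by
  induction n with
  | zero => rfl
  | succ k ih =>
    rw [pow_succ', ← ih, genPow, List.replicate_succ, ← List.singleton_append, mk_app]
    rfl

lemma mk_pow_false (x : Fin 46) (n : ℕ) :
    FreeGroup.mk (genPow x false n) = (FreeGroup.of x ^ n)⁻¹ := by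
  induction n with
  | zero => simp [genPow]; rfl
  | succ k ih =>
    rw [pow_succ, mul_inv_rev, ← ih, genPow, List.replicate_succ, ← List.singleton_append, mk_app]
    rfl

lemma mk_aWord (j : ℕ) : FreeGroup.mk (aWord j) =
    (List.ofFn fun k : Fin 20 => FreeGroup.of (genA k) ^ j).prod := by
  simp only [aWord, mk_flatten, List.map_ofFn, Function.comp_def, mk_pow_true]

lemma mk_bWord (j : ℕ) : FreeGroup.mk (bWord j) =
    (List.ofFn fun k : Fin 20 => FreeGroup.of (genB k) ^ j).prod := by
  simp only [bWord, mk_flatten, List.map_ofFn, Function.comp_def, mk_pow_true]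

lemma mk_bWordRevInv (j : ℕ) :
    FreeGroup.mk (bWordRevInv j) = (FreeGroup.mk (bWord j))⁻¹ := by
  rw [mk_bWord, List.prod_inv_reverse, List.map_ofFn, bWordRevInv, mk_flatten, List.map_ofFn]
  congr 1
  apply List.ext_getElem
  · simp
  · intro k h1 h2
    simp [mk_pow_false, Fin.rev]

lemma mk_conjWordInv (i ti : ℕ) :
    FreeGroup.mk (conjWordInv i ti) = (FreeGroup.mk (conjWord i ti))⁻¹ := by
  simp only [conjWordInv, conjWord, mk_app, mk_pow_true, mk_pow_false, mul_inv_rev, mul_assoc]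

lemma conj_of_mem (S : Set ℕ) (t : ℕ → ℕ) (i : ℕ) (hi : 1 ≤ i) (h : i ∈ S) :
    IsConj (mkP S t (aWord i)) (mkP S t (bWord i)) := by
  have hr : (QuotientGroup.mk (FreeGroup.mk (relatorWordP S t i)) : GroupP S t) = 1 :=
    (QuotientGroup.eq_one_iff _).2 (Subgroup.subset_normalClosure ⟨i, hi, rfl⟩)
  rw [relatorWordP, if_pos h] at hr
  simp only [mk_app, mk_bWordRevInv, mk_conjWordInv, QuotientGroup.mk_mul,
    QuotientGroup.mk_inv] at hr
  apply IsConj.symm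
  rw [isConj_iff]
  refine ⟨QuotientGroup.mk (FreeGroup.mk (conjWord i (t i))), ?_⟩
  refine (eq_of_mul_inv_eq_one (Eq.trans ?_ hr)).symm
  simp only [mkP]
  group

lemma conj_of_notMem (S : Set ℕ) (t : ℕ → ℕ) (i : ℕ) (hi : 1 ≤ i) (h : i ∉ S) :
    IsConj (mkP S t (aWord i)) (mkP S t (bWord i))⁻¹ := by
  have hr : (QuotientGroup.mk (FreeGroup.mk (relatorWordP S t i)) : GroupP S t) = 1 :=
    (QuotientGroup.eq_one_iff _).2 (Subgroup.subset_normalClosure ⟨i, hi, rfl⟩)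
  rw [relatorWordP, if_neg h] at hr
  simp only [mk_app, mk_conjWordInv, QuotientGroup.mk_mul, QuotientGroup.mk_inv] at hr
  apply IsConj.symm
  rw [isConj_iff]
  refine ⟨QuotientGroup.mk (FreeGroup.mk (conjWord i (t i))), ?_⟩
  refine (eq_of_mul_inv_eq_one (Eq.trans ?_ hr)).symm
  simp only [mkP]
  group

/-- Images of the generators: four of the `a`s and four of the `b`s are nontrivial. -/
def genMap {Q : Type} [Group Q] (p q : Fin 4 → Q) (k : Fin 46) : Q :=
  if h : (k : ℕ) < 4 then p ⟨k, h⟩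
  else if h : 20 ≤ (k : ℕ) ∧ (k : ℕ) < 24 then q ⟨k - 20, by omega⟩ else 1

lemma lift_aWord {Q : Type} [Group Q] (p q : Fin 4 → Q) (j : ℕ) :
    FreeGroup.lift (genMap p q) (FreeGroup.mk (aWord j)) =
      p 0 ^ j * p 1 ^ j * p 2 ^ j * p 3 ^ j := by
  rw [mk_aWord, map_list_prod, List.map_ofFn]
  simp [List.ofFn_succ, genMap, genA, mul_assoc, Fin.succ]

lemma lift_bWord {Q : Type} [Group Q] (p q : Fin 4 → Q) (j : ℕ) :
    FreeGroup.lift (genMap p q) (FreeGroup.mk (bWord j)) =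
      q 0 ^ j * q 1 ^ j * q 2 ^ j * q 3 ^ j := by
  rw [mk_bWord, map_list_prod, List.map_ofFn]
  simp [List.ofFn_succ, genMap, genB, mul_assoc, Fin.succ]

lemma lift_conjWord {Q : Type} [Group Q] (p q : Fin 4 → Q) (j k : ℕ) :
    FreeGroup.lift (genMap p q) (FreeGroup.mk (conjWord j k)) = 1 := by
  simp [conjWord, mk_app, mk_pow_true, genMap, genC, genD]

/-- A homomorphism from `P` to a group in which `α_i` goes to a central element `z ≠ z⁻¹`. -/
lemma exists_hom (S : Set ℕ) (t : ℕ → ℕ) (i : ℕ) (hi : 1 ≤ i) :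
    ∃ (Q : Type) (_ : Group Q) (z : Q) (φ : GroupP S t →* Q),
      (∀ g, z * g = g * z) ∧ z ≠ z⁻¹ ∧ φ (mkP S t (aWord i)) = z := by
  classical
  obtain ⟨Q, _, x, s, z, hc, hz, hn⟩ := exists_group i hi
  let p : Fin 4 → Q := ![x * s * x⁻¹, x ^ 2 * s⁻¹ * (x ^ 2)⁻¹, x * s * x⁻¹, s⁻¹]
  let p' : Fin 4 → Q := ![x⁻¹ * s * x, s⁻¹, x * s * x⁻¹, s⁻¹]
  let q : Fin 4 → Q := if i ∈ S then p else p'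
  have hp : ∀ n : ℕ, 1 ≤ n → p 0 ^ n * p 1 ^ n * p 2 ^ n * p 3 ^ n = if n = i then z else 1 := by
    intro n h
    rw [← hn n h]
    simp only [p, Matrix.cons_val, conj_pow, inv_pow]
    group
  have hp' : ∀ n : ℕ, 1 ≤ n →
      p' 0 ^ n * p' 1 ^ n * p' 2 ^ n * p' 3 ^ n = (if n = i then z else 1)⁻¹ := by
    intro n h
    have e : (if n = i then z else 1)⁻¹ = x⁻¹ * (if n = i then z else 1)⁻¹ * x := by
      split_ifs
      · have h1 := hc x
        have h2 : z⁻¹ * x = x * z⁻¹ := by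
          rw [inv_mul_eq_iff_eq_mul, ← mul_assoc, h1, mul_inv_cancel_right]
        rw [mul_assoc, h2, inv_mul_cancel_left]
      · simp
    rw [e, ← hn n h]
    have e0 : p' 0 ^ n = x⁻¹ * s ^ n * x := by
      have := conj_pow (i := n) (a := x⁻¹) (b := s)
      rw [inv_inv] at this
      exact this
    rw [e0]
    simp only [p', Matrix.cons_val, conj_pow, inv_pow]
    group
  have hker : Subgroup.normalClosure (relatorSetP S t) ≤ (FreeGroup.lift (genMap p q)).ker := by
    apply Subgroup.normalClosure_le_normal
    rintro r ⟨n, h, rfl⟩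
    rw [SetLike.mem_coe, MonoidHom.mem_ker, relatorWordP]
    by_cases hS : n ∈ S
    · rw [if_pos hS]
      simp only [mk_app, map_mul, mk_bWordRevInv, mk_conjWordInv, map_inv, lift_aWord, lift_bWord,
        lift_conjWord, hp n h]
      by_cases hiS : i ∈ S
      · simp only [q, if_pos hiS, hp n h]; group
      · have : n ≠ i := fun e => hiS (e ▸ hS)
        simp only [q, if_neg hiS, hp' n h, if_neg this]; group
    · rw [if_neg hS]
      simp only [mk_app, map_mul, mk_conjWordInv, map_inv, lift_aWord, lift_bWord,
        lift_conjWord, hp n h]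
      by_cases hiS : i ∈ S
      · have : n ≠ i := fun e => hS (e ▸ hiS)
        simp only [q, if_pos hiS, hp n h, if_neg this]; group
      · simp only [q, if_neg hiS, hp' n h]; group
  refine ⟨Q, inferInstance, z, QuotientGroup.lift _ (FreeGroup.lift (genMap p q)) hker, hc, hz, ?_⟩
  rw [mkP, QuotientGroup.lift_mk, lift_aWord, hp i hi, if_pos rfl]

/-- The element `α_i` is not conjugate to its inverse. -/
lemma not_conj_inv (S : Set ℕ) (t : ℕ → ℕ) (i : ℕ) (hi : 1 ≤ i) :
    ¬ IsConj (mkP S t (aWord i)) (mkP S t (aWord i))⁻¹ := by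
  obtain ⟨Q, _, z, φ, hc, hz, ha⟩ := exists_hom S t i hi
  intro h
  obtain ⟨g, hg⟩ := isConj_iff.1 (φ.map_isConj h)
  rw [map_inv, ha, ← hc, mul_inv_cancel_right] at hg
  exact hz hg

lemma isConj_inv {G : Type*} [Group G] {a b : G} (h : IsConj a b) : IsConj a⁻¹ b⁻¹ := by
  obtain ⟨g, rfl⟩ := isConj_iff.1 h
  exact isConj_iff.2 ⟨g, by group⟩

lemma not_both (S : Set ℕ) (t : ℕ → ℕ) (i : ℕ) (hi : 1 ≤ i)
    (h : IsConj (mkP S t (aWord i)) (mkP S t (bWord i)))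
    (h' : IsConj (mkP S t (aWord i)) (mkP S t (bWord i))⁻¹) : False :=
  not_conj_inv S t i hi (h'.trans (isConj_inv h).symm)

end HalfConj

/-- In `P`, for every `i ≥ 1` the element `α_i = mk(a₁^i ⋯ a₂₀^i)` is conjugate to
`β_i = mk(b₁^i ⋯ b₂₀^i)` or to `β_i⁻¹`; moreover `α_i` is conjugate to `β_i` iff `i ∈ S`,
and `α_i` is conjugate to `β_i⁻¹` iff `i ∉ S`. -/
theorem half_conjugacy (S : Set ℕ) (t : ℕ → ℕ) (ht1 : ∀ i : ℕ, 1 ≤ i → 1 ≤ t i)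
    (i : ℕ) (hi : 1 ≤ i) :
    (IsConj (mkP S t (aWord i)) (mkP S t (bWord i)) ∨
        IsConj (mkP S t (aWord i)) (mkP S t (bWord i))⁻¹) ∧
    (IsConj (mkP S t (aWord i)) (mkP S t (bWord i)) ↔ i ∈ S) ∧
    (IsConj (mkP S t (aWord i)) (mkP S t (bWord i))⁻¹ ↔ i ∉ S) := by
  by_cases h : i ∈ S
  · have h1 := HalfConj.conj_of_mem S t i hi h
    exact ⟨Or.inl h1, ⟨fun _ => h, fun _ => h1⟩,
      ⟨fun h2 => (HalfConj.not_both S t i hi h1 h2).elim, fun h2 => absurd h h2⟩⟩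
  · have h1 := HalfConj.conj_of_notMem S t i hi h
    exact ⟨Or.inr h1, ⟨fun h2 => (HalfConj.not_both S t i hi h2 h1).elim, fun h2 => absurd h2 h⟩,
      ⟨fun _ => h, fun _ => h1⟩⟩
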